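/- arXiv:1602.08340 — 3 statements merged into one kernel-verified Lean document; each statement's English description precedes it below -/
import Mathlib

section
/- Let k ≥ 2 be an integer. Assume μ is the unique σ-invariant Borel probability measure on Σ_{s_k}. Let g : A_k^ℕ → ℝ be continuous and positive, let h : A_k^ℕ → ℝ be continuous and vanish identically on Σ_{s_k}, and define V(x) = (g(x) + h(x))/δ_{s_k}(x) for δ_{s_k}(x) < ∞ and V(x) = 0 on Σ_{s_k}; assume V ≥ 0. Then for every x ∈ A_k^ℕ \ Σ_{s_k}, (R^n V)(x) converges as n → ∞ to (∫_{Σ_{s_k}} g dμ) · U(x). -/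
/-- The `k`-bonacci substitution on letters: `a ↦ 0(a+1)` if `a ≠ k-1`, and `k-1 ↦ 0`. -/
def sLetter {k : ℕ} (a : Fin k) : List (Fin k) :=
  if h : (a : ℕ) + 1 < k then
    [⟨0, Nat.lt_of_le_of_lt (Nat.zero_le _) a.isLt⟩, ⟨(a : ℕ) + 1, h⟩]
  else
    [⟨0, Nat.lt_of_le_of_lt (Nat.zero_le _) a.isLt⟩]

/-- Extension of the substitution to finite words by concatenation. -/
def sWord {k : ℕ} (w : List (Fin k)) : List (Fin k) := w.flatMap sLetter

/-- The prefix of length `n` of a right-infinite sequence. -/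
def pref {k : ℕ} (x : ℕ → Fin k) (n : ℕ) : List (Fin k) :=
  (List.range n).map x

/-- Extension of the substitution to right-infinite sequences, by concatenating the
images of the letters: since each letter has a nonempty image, the `m`-th letter of the
image is the `m`-th letter of the image of the prefix of length `m+1`. -/
def sSeq {k : ℕ} (x : ℕ → Fin k) : ℕ → Fin k :=
  fun m => (sWord (pref x (m + 1))).getD m (x 0)

/-- The left shift on sequences. -/
def shift {k : ℕ} (x : ℕ → Fin k) : ℕ → Fin k := fun n => x (n + 1)

/-- The language of the substitution: finite words occurring as a subword of some `s^m(a)`. -/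
def Lang {k : ℕ} (w : List (Fin k)) : Prop :=
  ∃ (a : Fin k) (m : ℕ), w <:+: sWord^[m] [a]

/-- `delta x = sup {n : prefix of x of length n is in the language}`, valued in `ℕ∞`. -/
noncomputable def delta {k : ℕ} (x : ℕ → Fin k) : ℕ∞ :=
  sSup {N : ℕ∞ | ∃ n : ℕ, N = (n : ℕ∞) ∧ Lang (pref x n)}

/-- The subshift associated to the substitution: sequences all of whose subwords
lie in the language. -/
def Attr (k : ℕ) : Set (ℕ → Fin k) :=
  {x | ∀ i n, Lang ((List.range n).map (fun j => x (i + j)))}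

/-- The renormalization operator. -/
noncomputable def Renorm {k : ℕ} (V : (ℕ → Fin k) → ℝ) : (ℕ → Fin k) → ℝ :=
  fun x => ∑ j ∈ Finset.range (sLetter (x 0)).length, V (shift^[j] (sSeq x))

/-- `vcoef k lam l = lam^{-(k-1-l)} * ∑_{j=0}^{k-1-l} lam^j`. -/
noncomputable def vcoef (k : ℕ) (lam : ℝ) (l : ℕ) : ℝ :=
  (∑ j ∈ Finset.range (k - l), lam ^ j) / lam ^ (k - 1 - l)

/-- The fixed point of the renormalization operator. -/
noncomputable def Ufix (k : ℕ) (lam : ℝ) (x : ℕ → Fin k) : ℝ :=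
  if delta x = ⊤ then 0
  else Real.log (1 + vcoef k lam (x 0) /
    (lam / (lam - 1)
      + (∑ l : Fin k, vcoef k lam (l : ℕ) * ((pref x (delta x).toNat).count l : ℝ))
      - vcoef k lam (x 0)))

/-- The word `s^n(0) · s^{n-1}(0) ⋯ s(0) · 0`. -/
def bword {k : ℕ} (z : Fin k) (n : ℕ) : List (Fin k) :=
  ((List.range (n + 1)).map (fun i => sWord^[n - i] [z])).flatten

/-- The word `s^{n-1}(0) · s^{n-2}(0) ⋯ s(0) · 0`. -/
def bsuffix {k : ℕ} (z : Fin k) (n : ℕ) : List (Fin k) :=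
  ((List.range n).map (fun i => sWord^[n - 1 - i] [z])).flatten


section Combinatorics

variable {k : ℕ}

lemma sWord_nil : sWord ([] : List (Fin k)) = [] := rfl

lemma sWord_cons (a : Fin k) (w : List (Fin k)) : sWord (a :: w) = sLetter a ++ sWord w := by
  simp [sWord]

lemma sWord_append (v w : List (Fin k)) : sWord (v ++ w) = sWord v ++ sWord w := by
  simp [sWord]

lemma sWord_singleton (a : Fin k) : sWord [a] = sLetter a := by
  simp [sWord]

lemma iterate_sWord_append (m : ℕ) (v w : List (Fin k)) :
    sWord^[m] (v ++ w) = sWord^[m] v ++ sWord^[m] w := by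
  induction m generalizing v w with
  | zero => rfl
  | succ m ih => simp only [Function.iterate_succ_apply, sWord_append, ih]

lemma Lang.of_infix {u v : List (Fin k)} (hv : Lang v) (h : u <:+: v) : Lang u := by
  obtain ⟨a, m, hm⟩ := hv
  exact ⟨a, m, h.trans hm⟩

lemma sWord_infix {u v : List (Fin k)} (h : u <:+: v) : sWord u <:+: sWord v := by
  obtain ⟨p, q, rfl⟩ := h
  exact ⟨sWord p, sWord q, by simp [sWord_append]⟩

lemma Lang.image {u : List (Fin k)} (hu : Lang u) : Lang (sWord u) := by
  obtain ⟨a, m, hm⟩ := hu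
  exact ⟨a, m + 1, by rw [Function.iterate_succ_apply']; exact sWord_infix hm⟩

lemma Lang.iterate_image {u : List (Fin k)} (hu : Lang u) (m : ℕ) : Lang (sWord^[m] u) := by
  induction m with
  | zero => exact hu
  | succ m ih => rw [Function.iterate_succ_apply']; exact ih.image

lemma lang_singleton (a : Fin k) : Lang [a] := ⟨a, 0, List.infix_refl _⟩

variable [NeZero k]

/-- The last letter of `sLetter a`, i.e. the cyclic successor of `a`. -/
def nextLetter (a : Fin k) : Fin k :=
  if h : (a : ℕ) + 1 < k then ⟨(a : ℕ) + 1, h⟩ else 0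

lemma nextLetter_injective : Function.Injective (nextLetter : Fin k → Fin k) := by
  intro a b hab
  have ha := a.isLt
  have hb := b.isLt
  unfold nextLetter at hab
  split_ifs at hab with h1 h2 h2 <;> simp only [Fin.ext_iff, Fin.val_zero] at hab ⊢ <;> omega

lemma sLetter_eq (a : Fin k) :
    sLetter a = if nextLetter a = 0 then [0] else [0, nextLetter a] := by
  unfold sLetter nextLetter
  split_ifs with h1 h2 h2
  · exact absurd (congrArg Fin.val h2) (by rw [Fin.val_zero]; exact Nat.succ_ne_zero _)
  · rfl
  · rfl
  · exact absurd rfl h2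

lemma exists_sLetter_eq_cons (a : Fin k) : ∃ t, sLetter a = 0 :: t := by
  rw [sLetter_eq]
  split_ifs
  exacts [⟨_, rfl⟩, ⟨_, rfl⟩]

lemma sLetter_length_pos (a : Fin k) : 0 < (sLetter a).length := by
  obtain ⟨t, ht⟩ := exists_sLetter_eq_cons a
  simp [ht]

lemma exists_sWord_eq_cons {w : List (Fin k)} (hw : w ≠ []) : ∃ t, sWord w = 0 :: t := by
  obtain ⟨a, w, rfl⟩ := List.exists_cons_of_ne_nil hw
  obtain ⟨t, ht⟩ := exists_sLetter_eq_cons a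
  exact ⟨t ++ sWord w, by rw [sWord_cons, ht]; rfl⟩

lemma sWord_ne_nil {w : List (Fin k)} (hw : w ≠ []) : sWord w ≠ [] := by
  obtain ⟨t, ht⟩ := exists_sWord_eq_cons hw
  simp [ht]

lemma iterate_sWord_ne_nil (m : ℕ) {w : List (Fin k)} (hw : w ≠ []) : sWord^[m] w ≠ [] := by
  induction m generalizing w with
  | zero => exact hw
  | succ m ih => exact ih (sWord_ne_nil hw)

/-- Every letter image starts a new block, so a prefix of an image that determines the last
block can be desubstituted. -/
lemma prefix_of_sWord_prefix (w v : List (Fin k)) (a : Fin k)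
    (h : sWord w ++ [0, nextLetter a] <+: sWord v) : w ++ [a] <+: v := by
  induction w generalizing v with
  | nil =>
    rcases v with _ | ⟨b, v⟩
    · simp [sWord_nil] at h
    · rw [sWord_nil, List.nil_append, sWord_cons, sLetter_eq] at h
      have hab : a = b := by
        apply nextLetter_injective
        split_ifs at h with hb
        · rw [List.cons_append, List.nil_append, List.cons_prefix_cons] at h
          have hv : v ≠ [] := by rintro rfl; simp [sWord_nil] at h
          obtain ⟨t, ht⟩ := exists_sWord_eq_cons hv
          rw [ht, List.cons_prefix_cons] at h
          rw [hb, h.2.1]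
        · simpa using h
      subst hab
      simp
  | cons c w ih =>
    rcases v with _ | ⟨b, v⟩
    · obtain ⟨t, ht⟩ := exists_sLetter_eq_cons c
      simp [sWord_nil, sWord_cons, ht] at h
    · obtain ⟨t, ht⟩ : ∃ t, sWord w ++ [0, nextLetter a] = 0 :: t := by
        by_cases hw : w = []
        · subst hw; exact ⟨_, rfl⟩
        · obtain ⟨t, ht⟩ := exists_sWord_eq_cons hw
          exact ⟨t ++ [0, nextLetter a], by rw [ht]; rfl⟩
      have hcb : c = b ∧ sWord w ++ [0, nextLetter a] <+: sWord v := by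
        rw [sWord_cons, sWord_cons, sLetter_eq, sLetter_eq, List.append_assoc] at h
        by_cases hc : nextLetter c = 0 <;> by_cases hb : nextLetter b = 0
        · refine ⟨nextLetter_injective (hc.trans hb.symm), ?_⟩
          simpa [hc, hb] using h
        · rw [ht] at h
          simp [hc, hb] at h
          exact absurd h.1.symm hb
        · have hv : v ≠ [] := by rintro rfl; simp [sWord_nil, hc, hb] at h
          obtain ⟨t', ht'⟩ := exists_sWord_eq_cons hv
          rw [ht'] at h
          simp [hc, hb] at h
        · simp only [hc, hb, if_false, List.cons_append, List.nil_append,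
            List.cons_prefix_cons] at h
          exact ⟨nextLetter_injective h.2.1, h.2.2⟩
      obtain ⟨rfl, h2⟩ := hcb
      simpa using ih v h2

lemma infix_of_drop_sWord_infix (w v : List (Fin k)) (x a : Fin k) (i : ℕ)
    (hi : i < (sLetter x).length)
    (h : (sWord (x :: w) ++ [0, nextLetter a]).drop i <:+: sWord v) :
    x :: w ++ [a] <:+: v := by
  obtain ⟨p, q, hpq⟩ := h
  induction v generalizing p with
  | nil =>
    have := congrArg List.length hpq
    simp [sWord_nil, sWord_cons] at this
    omega
  | cons b v ih =>
    by_cases hp : (sLetter b).length ≤ p.length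
    · have hpre : sLetter b <+: p := by
        refine List.prefix_of_prefix_length_le (l₃ := sWord (b :: v)) ?_ ?_ hp
        · rw [sWord_cons]; exact List.prefix_append _ _
        · rw [← hpq, List.append_assoc]; exact List.prefix_append _ _
      obtain ⟨p', rfl⟩ := hpre
      rw [sWord_cons b, List.append_assoc, List.append_assoc, List.append_cancel_left_eq,
        ← List.append_assoc] at hpq
      exact (ih p' hpq).trans (List.suffix_cons b v).isInfix
    · suffices hs : sWord (x :: w) ++ [0, nextLetter a] <+: sWord (b :: v) from
        (prefix_of_sWord_prefix _ _ _ hs).isInfix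
      push Not at hp
      rw [sWord_cons, sWord_cons, sLetter_eq, sLetter_eq] at hpq
      rw [sLetter_eq] at hi hp
      by_cases hi0 : i = 0
      · subst hi0
        have hp0 : p = [] := by
          by_contra hne
          obtain ⟨c, p', rfl⟩ := List.exists_cons_of_ne_nil hne
          by_cases hb : nextLetter b = 0
          · simp [hb] at hp
          · have hp' : p' = [] := by simpa [hb] using hp
            subst hp'
            obtain ⟨t, ht⟩ := exists_sLetter_eq_cons x
            rw [← sLetter_eq x, ht] at hpq
            simp [hb] at hpq
            exact hb hpq.2.1.symm
        subst hp0
        refine ⟨q, ?_⟩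
        rw [sWord_cons, sWord_cons, sLetter_eq, sLetter_eq]
        simpa using hpq
      · by_cases hx : nextLetter x = 0
        · simp [hx] at hi; omega
        · have hi1 : i = 1 := by simp [hx] at hi; omega
          subst hi1
          simp only [hx, if_false, List.cons_append, List.nil_append, List.drop_succ_cons,
            List.drop_zero] at hpq
          rcases p with _ | ⟨c, p'⟩
          · exfalso
            split_ifs at hpq <;> simp at hpq <;> exact hx hpq.1
          · by_cases hb : nextLetter b = 0
            · simp [hb] at hp
            · have hp' : p' = [] := by simpa [hb] using hp
              subst hp'
              simp only [hb, if_false, List.cons_append, List.nil_append,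
                List.cons.injEq] at hpq
              refine ⟨q, ?_⟩
              rw [sWord_cons, sWord_cons, sLetter_eq, sLetter_eq]
              simp only [hb, if_false, List.cons_append, List.nil_append, hpq.2.1, ← hpq.2.2]

lemma lang_of_drop_sWord (w : List (Fin k)) (x a : Fin k) (i : ℕ)
    (hi : i < (sLetter x).length)
    (h : Lang ((sWord (x :: w) ++ [0, nextLetter a]).drop i)) :
    Lang (x :: w ++ [a]) := by
  obtain ⟨b, m, hm⟩ := h
  rcases m with _ | m
  · have h1 := hm.length_le
    simp [sWord_cons] at h1
    omega
  · rw [Function.iterate_succ_apply'] at hm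
    exact ⟨b, m, infix_of_drop_sWord_infix _ _ _ _ _ hi hm⟩

lemma lang_pair (hk : 2 ≤ k) (a : Fin k) : Lang [a, 0] := by
  have key : ∀ (n : ℕ) (hn : n + 1 < k), Lang [(⟨n + 1, hn⟩ : Fin k), 0] := by
    have h0 : nextLetter (0 : Fin k) = ⟨1, hk⟩ := by
      simp [nextLetter, show 1 < k from hk]
    have h0' : nextLetter (0 : Fin k) ≠ 0 := by rw [h0]; simp [Fin.ext_iff]
    intro n
    induction n with
    | zero =>
      intro hn
      obtain ⟨t, ht⟩ := exists_sLetter_eq_cons (nextLetter (0 : Fin k))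
      refine ⟨0, 2, [0], t, ?_⟩
      simp only [Function.iterate_succ_apply, Function.iterate_zero, id, sWord_singleton]
      rw [sLetter_eq, if_neg h0', sWord_cons, sWord_singleton, ht, sLetter_eq, if_neg h0', h0]
      rfl
    | succ n ih =>
      intro hn
      refine (ih (by omega)).image.of_infix ⟨[0], [nextLetter 0], ?_⟩
      have h1 : nextLetter (⟨n + 1, by omega⟩ : Fin k) = ⟨n + 1 + 1, hn⟩ := by
        simp [nextLetter, hn]
      have h2 : nextLetter (⟨n + 1, by omega⟩ : Fin k) ≠ 0 := by rw [h1]; simp [Fin.ext_iff]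
      rw [sWord_cons, sWord_singleton, sLetter_eq, sLetter_eq, if_neg h2, if_neg h0', h1]
      rfl
  by_cases ha : (a : ℕ) = 0
  · have ha' : a = 0 := Fin.ext ha
    subst ha'
    obtain ⟨n, hn⟩ : ∃ n, k = n + 2 := ⟨k - 2, by omega⟩
    refine (key n (by omega)).image.of_infix ⟨[], [nextLetter 0], ?_⟩
    have h1 : nextLetter (⟨n + 1, by omega⟩ : Fin k) = 0 := by
      simp [nextLetter, hn]
    have h0' : nextLetter (0 : Fin k) ≠ 0 := by
      simp [nextLetter, Fin.ext_iff, show 1 < k from hk]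
    rw [sWord_cons, sWord_singleton, sLetter_eq, sLetter_eq, if_pos h1, if_neg h0']
    rfl
  · obtain ⟨n, hn⟩ := Nat.exists_eq_succ_of_ne_zero ha
    have := key n (by have := a.isLt; omega)
    convert this

lemma Lang.image_append_zero (hk : 2 ≤ k) {w : List (Fin k)} (hw : Lang w) :
    Lang (sWord w ++ [0]) := by
  obtain ⟨a, m, p, q, hpq⟩ := hw
  have h1 : Lang (sWord^[m] [a] ++ sWord^[m] [0]) := by
    rw [← iterate_sWord_append]
    exact Lang.iterate_image (lang_pair hk a) m
  have h2 : q ++ sWord^[m] [(0 : Fin k)] ≠ [] := by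
    simp [iterate_sWord_ne_nil m (w := [(0 : Fin k)]) (by simp)]
  obtain ⟨t, ht⟩ := exists_sWord_eq_cons h2
  refine h1.image.of_infix ⟨sWord p, t, ?_⟩
  rw [← hpq, List.append_assoc (p ++ w), sWord_append (p ++ w), ht, sWord_append]
  simp

end Combinatorics


section Sequences

variable {k : ℕ}

lemma pref_length (x : ℕ → Fin k) (n : ℕ) : (pref x n).length = n := by
  simp [pref]

lemma pref_succ (x : ℕ → Fin k) (n : ℕ) : pref x (n + 1) = pref x n ++ [x n] := by
  simp [pref, List.range_succ]

lemma pref_zero (x : ℕ → Fin k) : pref x 0 = [] := rfl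

lemma shift_iterate_apply (x : ℕ → Fin k) (j n : ℕ) : shift^[j] x n = x (j + n) := by
  induction j generalizing n with
  | zero => simp
  | succ j ih =>
    rw [Function.iterate_succ_apply', shift, ih]
    congr 1
    omega

lemma pref_add (x : ℕ → Fin k) (m n : ℕ) : pref x (m + n) = pref x m ++ pref (shift^[m] x) n := by
  induction n with
  | zero => simp [pref_zero]
  | succ n ih => rw [← Nat.add_assoc, pref_succ, ih, pref_succ, shift_iterate_apply,
      List.append_assoc]

lemma pref_one (x : ℕ → Fin k) : pref x 1 = [x 0] := rfl

lemma exists_pref_eq_cons (x : ℕ → Fin k) {n : ℕ} (hn : 0 < n) :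
    ∃ w, pref x n = x 0 :: w := by
  obtain ⟨m, rfl⟩ : ∃ m, n = 1 + m := ⟨n - 1, by omega⟩
  exact ⟨_, by rw [pref_add, pref_one]; rfl⟩

lemma pref_prefix (x : ℕ → Fin k) {m n : ℕ} (h : m ≤ n) : pref x m <+: pref x n := by
  obtain ⟨d, rfl⟩ := Nat.exists_eq_add_of_le h
  rw [pref_add]
  exact List.prefix_append _ _

lemma pref_drop (x : ℕ → Fin k) (m n : ℕ) : (pref x (m + n)).drop m = pref (shift^[m] x) n := by
  rw [pref_add]
  exact List.drop_left' (pref_length x m)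

lemma pref_getElem? (x : ℕ → Fin k) {m n : ℕ} (h : m < n) : (pref x n)[m]? = some (x m) := by
  simp [pref, h]

lemma eq_pref_of_getElem? (x : ℕ → Fin k) (w : List (Fin k))
    (h : ∀ m < w.length, w[m]? = some (x m)) : w = pref x w.length := by
  refine List.ext_getElem? fun m => ?_
  by_cases hm : m < w.length
  · rw [h m hm, pref_getElem? x hm]
  · rw [List.getElem?_eq_none (by omega), List.getElem?_eq_none (by rw [pref_length]; omega)]

/-- `n` is the length of the longest prefix of `x` lying in the language. -/
def IsDelta (x : ℕ → Fin k) (n : ℕ) : Prop := Lang (pref x n) ∧ ¬ Lang (pref x (n + 1))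

lemma IsDelta.pos {x : ℕ → Fin k} {n : ℕ} (h : IsDelta x n) : 0 < n := by
  rcases Nat.eq_zero_or_pos n with rfl | hn
  · exact absurd (lang_singleton (x 0)) h.2
  · exact hn

lemma IsDelta.delta_eq {x : ℕ → Fin k} {n : ℕ} (h : IsDelta x n) : delta x = n := by
  refine le_antisymm (sSup_le ?_) (le_sSup ⟨n, rfl, h.1⟩)
  rintro _ ⟨m, rfl, hm⟩
  by_contra hlt
  have hlt' : n + 1 ≤ m := by
    simp only [not_le, Nat.cast_lt] at hlt
    omega
  exact h.2 (hm.of_infix (pref_prefix x hlt').isInfix)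

lemma pref_shift_iterate (x : ℕ → Fin k) (i n : ℕ) :
    (List.range n).map (fun j => x (i + j)) = pref (shift^[i] x) n := by
  simp [pref, shift_iterate_apply]

lemma exists_isDelta {x : ℕ → Fin k} (hx : x ∉ Attr k) : ∃ n, IsDelta x n := by
  by_contra hcon
  simp only [IsDelta, not_exists, not_and, not_not] at hcon
  have hall : ∀ n, Lang (pref x n) := by
    intro n
    induction n with
    | zero => exact (lang_singleton (x 0)).of_infix (by simp [pref_zero])
    | succ n ih => exact hcon n ih
  apply hx
  intro i n
  rw [pref_shift_iterate, ← pref_drop]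
  exact (hall (i + n)).of_infix (List.drop_suffix _ _).isInfix

lemma exists_block {y : ℕ → Fin k} {m j : ℕ} (hj : j < (sWord (pref y m)).length) :
    ∃ l < m, ∃ i < (sLetter (y l)).length, j = (sWord (pref y l)).length + i := by
  induction m with
  | zero => simp [pref_zero, sWord_nil] at hj
  | succ m ih =>
    by_cases h : j < (sWord (pref y m)).length
    · obtain ⟨l, hl, r⟩ := ih h
      exact ⟨l, by omega, r⟩
    · rw [pref_succ, sWord_append, sWord_singleton, List.length_append] at hj
      exact ⟨m, by omega, j - (sWord (pref y m)).length, by omega, by omega⟩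

variable [NeZero k]

lemma length_le_sWord_length (w : List (Fin k)) : w.length ≤ (sWord w).length := by
  induction w with
  | nil => simp
  | cons a w ih =>
    have := sLetter_length_pos a
    simp [sWord_cons]
    omega

lemma sSeq_eq_getElem? (x : ℕ → Fin k) {m i : ℕ} (h : m < (sWord (pref x i)).length) :
    (sWord (pref x i))[m]? = some (sSeq x m) := by
  have hm : m < (sWord (pref x (m + 1))).length := by
    have := length_le_sWord_length (pref x (m + 1))
    rw [pref_length] at this
    omega
  have key : ∀ a b, a ≤ b → m < (sWord (pref x a)).length →
      (sWord (pref x a))[m]? = (sWord (pref x b))[m]? := by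
    intro a b hab ha
    obtain ⟨t, ht⟩ := pref_prefix x hab
    rw [← ht, sWord_append, List.getElem?_append_left ha]
  have h1 : (sWord (pref x i))[m]? = (sWord (pref x (m + 1)))[m]? := by
    rcases le_total i (m + 1) with h' | h'
    · exact key _ _ h' h
    · exact (key _ _ h' hm).symm
  rw [h1, sSeq, List.getD_eq_getElem?_getD, List.getElem?_eq_getElem hm, Option.getD_some]

lemma pref_sSeq (x : ℕ → Fin k) (i : ℕ) :
    pref (sSeq x) (sWord (pref x i)).length = sWord (pref x i) :=
  (eq_pref_of_getElem? _ _ fun _ hm => sSeq_eq_getElem? x hm).symm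

lemma sSeq_shift (x : ℕ → Fin k) (j : ℕ) :
    sSeq (shift^[j] x) = shift^[(sWord (pref x j)).length] (sSeq x) := by
  funext m
  have hm : m < (sWord (pref (shift^[j] x) (m + 1))).length := by
    have := length_le_sWord_length (pref (shift^[j] x) (m + 1))
    rw [pref_length] at this
    omega
  have h2 : (sWord (pref x j)).length + m < (sWord (pref x (j + (m + 1)))).length := by
    rw [pref_add, sWord_append, List.length_append]
    omega
  have h3 := sSeq_eq_getElem? x h2
  rw [pref_add, sWord_append, List.getElem?_append_right (by omega), Nat.add_sub_cancel_left,
    sSeq_eq_getElem? _ hm] at h3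
  rw [shift_iterate_apply]
  exact Option.some.inj h3

lemma exists_sLetter_append_eq (a : Fin k) (t : List (Fin k)) :
    ∃ r, sLetter a ++ 0 :: t = [0, nextLetter a] ++ r := by
  rw [sLetter_eq]
  split_ifs with h
  · exact ⟨t, by rw [h]; rfl⟩
  · exact ⟨0 :: t, rfl⟩

lemma pref_sSeq_add_two (x : ℕ → Fin k) (n : ℕ) :
    pref (sSeq x) ((sWord (pref x n)).length + 2) = sWord (pref x n) ++ [0, nextLetter (x n)] := by
  obtain ⟨t, ht⟩ := exists_sLetter_eq_cons (x (n + 1))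
  obtain ⟨r, hr⟩ := exists_sLetter_append_eq (x n) t
  have h := pref_sSeq x (n + 2)
  rw [pref_succ, pref_succ, List.append_assoc, sWord_append, List.singleton_append, sWord_cons,
    sWord_singleton, ht, hr, ← List.append_assoc] at h
  have h' := (pref_prefix (sSeq x) (show (sWord (pref x n)).length + 2 ≤ _ + r.length from
    Nat.le_add_right _ _))
  have hl : (sWord (pref x n)).length + 2 + r.length
      = (sWord (pref x n) ++ [0, nextLetter (x n)] ++ r).length := by
    simp
    omega
  rw [hl, h] at h'
  exact (List.prefix_of_prefix_length_le h' (List.prefix_append _ _)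
    (by simp [pref_length])).eq_of_length (by simp [pref_length])

lemma pref_sSeq_add_one (x : ℕ → Fin k) (n : ℕ) :
    pref (sSeq x) ((sWord (pref x n)).length + 1) = sWord (pref x n) ++ [0] := by
  have h := pref_sSeq_add_two x n
  rw [pref_succ, show ([0, nextLetter (x n)] : List (Fin k)) = [0] ++ [nextLetter (x n)] from rfl,
    ← List.append_assoc] at h
  exact (List.append_inj' h rfl).1

lemma IsDelta.sSeq_shift (hk : 2 ≤ k) {x : ℕ → Fin k} {n : ℕ} (h : IsDelta x n) (hn : 0 < n)
    {i : ℕ} (hi : i < (sLetter (x 0)).length) :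
    IsDelta (shift^[i] (sSeq x)) ((sWord (pref x n)).length + 1 - i) := by
  obtain ⟨w, hw⟩ := exists_pref_eq_cons x hn
  have hle : i ≤ (sWord (pref x n)).length := by
    rw [hw, sWord_cons, List.length_append]
    omega
  constructor
  · rw [← pref_drop, show i + ((sWord (pref x n)).length + 1 - i)
      = (sWord (pref x n)).length + 1 by omega, pref_sSeq_add_one]
    exact (h.1.image_append_zero hk).of_infix (List.drop_suffix _ _).isInfix
  · intro h2
    rw [← pref_drop, show i + ((sWord (pref x n)).length + 1 - i + 1)
      = (sWord (pref x n)).length + 2 by omega, pref_sSeq_add_two, hw] at h2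
    apply h.2
    rw [pref_succ, hw]
    exact lang_of_drop_sWord w (x 0) (x n) i hi h2

variable (k) in
/-- The word `s^{n-1}(0) ⋯ s(0) 0`. -/
def zeroTail : ℕ → List (Fin k)
  | 0 => []
  | n + 1 => sWord^[n] [0] ++ zeroTail n

lemma sWord_zeroTail (n : ℕ) : sWord (zeroTail k n) ++ [0] = zeroTail k (n + 1) := by
  induction n with
  | zero => simp [zeroTail, sWord_nil]
  | succ n ih =>
    rw [zeroTail, sWord_append, List.append_assoc, ih, ← Function.iterate_succ_apply' sWord]
    rfl

/-- The longest prefix in the language of the `n`-th image of a sequence whose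
longest prefix in the language is `w`. -/
def imagePrefix (w : List (Fin k)) (n : ℕ) : List (Fin k) := sWord^[n] w ++ zeroTail k n

lemma imagePrefix_succ (w : List (Fin k)) (n : ℕ) :
    imagePrefix w (n + 1) = sWord (imagePrefix w n) ++ [0] := by
  rw [imagePrefix, imagePrefix, sWord_append, List.append_assoc, sWord_zeroTail,
    ← Function.iterate_succ_apply' sWord]

lemma pref_iterate_sSeq (x : ℕ → Fin k) (N n : ℕ) :
    pref (sSeq^[n] x) (imagePrefix (pref x N) n).length = imagePrefix (pref x N) n := by
  induction n with
  | zero => simp [imagePrefix, zeroTail, pref_length]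
  | succ n ih =>
    have h := pref_sSeq_add_one (sSeq^[n] x) (imagePrefix (pref x N) n).length
    rw [ih] at h
    rw [Function.iterate_succ_apply', imagePrefix_succ, List.length_append]
    exact h

lemma pref_iterate_sSeq_letter (x : ℕ → Fin k) (n : ℕ) :
    pref (sSeq^[n] x) (sWord^[n] [x 0]).length = sWord^[n] [x 0] := by
  induction n with
  | zero => rfl
  | succ n ih =>
    have h := pref_sSeq (sSeq^[n] x) (sWord^[n] [x 0]).length
    rw [ih] at h
    rw [Function.iterate_succ_apply', Function.iterate_succ_apply', h]

lemma letter_length_le_imagePrefix_length (w : List (Fin k)) (a : Fin k) (n : ℕ) :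
    (sWord^[n] [a]).length + (zeroTail k n).length ≤ (imagePrefix (a :: w) n).length := by
  rw [imagePrefix, ← List.singleton_append (l := w), iterate_sWord_append]
  simp only [List.length_append]
  omega

lemma IsDelta.iterate_sSeq_shift (hk : 2 ≤ k) {x : ℕ → Fin k} {N : ℕ} (h : IsDelta x N) (n : ℕ)
    {j : ℕ} (hj : j < (sWord^[n] [x 0]).length) :
    IsDelta (shift^[j] (sSeq^[n] x)) ((imagePrefix (pref x N) n).length - j) := by
  induction n generalizing j with
  | zero =>
    have hj0 : j = 0 := by simpa using hj
    subst hj0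
    simpa [imagePrefix, zeroTail, pref_length] using h
  | succ n ih =>
    obtain ⟨w, hw⟩ := exists_pref_eq_cons x h.pos
    have hle := letter_length_le_imagePrefix_length w (x 0) n
    rw [← hw] at hle
    rw [Function.iterate_succ_apply', ← pref_iterate_sSeq_letter] at hj
    obtain ⟨l, hl, i, hi, rfl⟩ := exists_block hj
    have hz := ih hl
    have hi' : i < (sLetter (shift^[l] (sSeq^[n] x) 0)).length := by
      simpa [shift_iterate_apply] using hi
    have hz' := hz.sSeq_shift hk hz.pos hi'
    rw [_root_.sSeq_shift, ← Function.iterate_add_apply, ← Function.iterate_succ_apply' sSeq] at hz'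
    have hlen : (imagePrefix (pref x N) (n + 1)).length
        = (sWord (pref (sSeq^[n] x) l)).length
          + ((sWord (pref (shift^[l] (sSeq^[n] x)) ((imagePrefix (pref x N) n).length - l))).length
            + 1) := by
      rw [imagePrefix_succ, List.length_append, ← pref_iterate_sSeq x N n,
        show (imagePrefix (pref x N) n).length = l + ((imagePrefix (pref x N) n).length - l) by omega,
        pref_add, sWord_append, List.length_append]
      simp [Nat.add_assoc, pref_length]
    rw [hlen, Nat.add_sub_add_left]
    rwa [Nat.add_comm i] at hz'

lemma sum_renorm_shift (V : (ℕ → Fin k) → ℝ) (y : ℕ → Fin k) (m : ℕ) :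
    ∑ j ∈ Finset.range m, Renorm V (shift^[j] y)
      = ∑ i ∈ Finset.range (sWord (pref y m)).length, V (shift^[i] (sSeq y)) := by
  induction m with
  | zero => simp [pref_zero, sWord_nil]
  | succ m ih =>
    rw [Finset.sum_range_succ, ih, pref_succ, sWord_append, sWord_singleton, List.length_append,
      Finset.sum_range_add]
    congr 1
    rw [Renorm, sSeq_shift, shift_iterate_apply, Nat.add_zero]
    refine Finset.sum_congr rfl fun i _ => ?_
    rw [← Function.iterate_add_apply, Nat.add_comm]

lemma iterate_renorm (V : (ℕ → Fin k) → ℝ) (x : ℕ → Fin k) (n : ℕ) :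
    Renorm^[n] V x
      = ∑ j ∈ Finset.range (sWord^[n] [x 0]).length, V (shift^[j] (sSeq^[n] x)) := by
  induction n generalizing V with
  | zero => simp
  | succ n ih =>
    rw [Function.iterate_succ_apply, ih, sum_renorm_shift, pref_iterate_sSeq_letter,
      Function.iterate_succ_apply' sSeq, Function.iterate_succ_apply' sWord]

end Sequences

section Growth

open Filter Topology

/-- A Doeblin-type contraction: averaging with a uniform weight on a fixed coordinate
forces all coordinates to converge to a common positive limit. -/
lemma exists_common_limit {ι : Type*} (r : ℕ → ι → ℝ) (f : ι → ι) (t : ι → ℝ) (z : ι) (q : ℝ)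
    (hq : 0 < q) (htq : ∀ a, q ≤ t a) (ht1 : ∀ a, t a ≤ 1) (h0 : ∀ a, r 0 a = t a)
    (hr : ∀ n a, r (n + 1) a = t a * r n z + (1 - t a) * r n (f a)) :
    ∃ c, 0 < c ∧ ∀ a, Tendsto (fun n => r n a) atTop (𝓝 c) := by
  have hq1 : q ≤ 1 := (htq z).trans (ht1 z)
  have hlow : ∀ n a, q ≤ r n a := by
    intro n
    induction n with
    | zero => intro a; rw [h0]; exact htq a
    | succ n ih =>
      intro a
      rw [hr]
      nlinarith [mul_le_mul_of_nonneg_left (ih z) (hq.le.trans (htq a)),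
        mul_le_mul_of_nonneg_left (ih (f a)) (sub_nonneg.2 (ht1 a))]
  have hosc : ∀ n a b, r n a - r n b ≤ (1 - q) ^ n := by
    intro n
    induction n with
    | zero =>
      intro a b
      rw [h0, h0, pow_zero]
      linarith [ht1 a, htq b]
    | succ n ih =>
      intro a b
      have hE : 0 ≤ (1 - q) ^ n := pow_nonneg (by linarith) n
      rw [hr, hr, pow_succ]
      rcases le_total (t a) (t b) with hab | hab
      · have h1 := mul_le_mul_of_nonneg_left (ih (f a) (f b)) (sub_nonneg.2 (ht1 b))
        have h2 := mul_le_mul_of_nonneg_left (ih (f a) z) (sub_nonneg.2 hab)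
        have h3 := mul_le_mul_of_nonneg_left (htq a) hE
        nlinarith
      · have h1 := mul_le_mul_of_nonneg_left (ih (f a) (f b)) (sub_nonneg.2 (ht1 a))
        have h2 := mul_le_mul_of_nonneg_left (ih z (f b)) (sub_nonneg.2 hab)
        have h3 := mul_le_mul_of_nonneg_left (htq b) hE
        nlinarith
  have habs : ∀ n a b, |r n a - r n b| ≤ (1 - q) ^ n := fun n a b =>
    abs_sub_le_iff.2 ⟨hosc n a b, hosc n b a⟩
  have hcau : CauchySeq (fun n => r n z) := by
    refine cauchySeq_of_le_geometric (1 - q) 1 (by linarith) fun n => ?_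
    have hE : 0 ≤ (1 - q) ^ n := pow_nonneg (by linarith) n
    have htz := htq z
    have htz1 := ht1 z
    rw [Real.dist_eq, hr, one_mul,
      show r n z - (t z * r n z + (1 - t z) * r n (f z)) = (1 - t z) * (r n z - r n (f z)) by ring,
      abs_mul, abs_of_nonneg (by linarith)]
    nlinarith [mul_le_mul_of_nonneg_left (habs n z (f z)) (sub_nonneg.2 (ht1 z))]
  obtain ⟨c, hc⟩ := cauchySeq_tendsto_of_complete hcau
  refine ⟨c, hq.trans_le (ge_of_tendsto' hc fun n => hlow n z), fun a => ?_⟩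
  have hpow : Tendsto (fun n => (1 - q) ^ n) atTop (𝓝 0) :=
    tendsto_pow_atTop_nhds_zero_of_lt_one (by linarith) (by linarith)
  have hd : Tendsto (fun n => r n a - r n z) atTop (𝓝 0) :=
    squeeze_zero_norm (fun n => by rw [Real.norm_eq_abs]; exact habs n a z) hpow
  simpa using hd.add hc

lemma tendsto_sum_div_pow {lam A : ℝ} (hlam : 1 < lam) {u : ℕ → ℝ}
    (hu : Tendsto (fun n => u n / lam ^ n) atTop (𝓝 A)) :
    Tendsto (fun n => (∑ i ∈ Finset.range n, u i) / lam ^ n) atTop (𝓝 (A / (lam - 1))) := by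
  have hl0 : 0 < lam := by linarith
  have hgeom : ∀ n, ∑ i ∈ Finset.range n, lam ^ i = (lam ^ n - 1) / (lam - 1) := fun n =>
    geom_sum_eq hlam.ne' n
  have hinv : Tendsto (fun n : ℕ => 1 / lam ^ n) atTop (𝓝 0) := by
    simp_rw [one_div]
    exact tendsto_inv_atTop_zero.comp (tendsto_pow_atTop_atTop_of_one_lt hlam)
  have hg : Tendsto (fun n => (∑ i ∈ Finset.range n, lam ^ i) / lam ^ n) atTop
      (𝓝 (1 / (lam - 1))) := by
    have : Tendsto (fun n : ℕ => (1 - 1 / lam ^ n) / (lam - 1)) atTop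
        (𝓝 ((1 - 0) / (lam - 1))) := (tendsto_const_nhds.sub hinv).div_const _
    rw [sub_zero] at this
    refine this.congr fun n => ?_
    rw [hgeom]
    have : lam ^ n ≠ 0 := by positivity
    have : lam - 1 ≠ 0 := by linarith
    field_simp
  have ho : (fun n => u n - A * lam ^ n) =o[atTop] fun n => lam ^ n := by
    rw [Asymptotics.isLittleO_iff_tendsto' (Eventually.of_forall fun n h => absurd h (by positivity))]
    have := hu.sub_const A
    rw [sub_self] at this
    refine this.congr fun n => ?_
    have : lam ^ n ≠ 0 := by positivity
    field_simp
  have hS : Tendsto (fun n => ∑ i ∈ Finset.range n, lam ^ i) atTop atTop := by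
    simp_rw [hgeom]
    exact (tendsto_atTop_add_const_right _ _ (tendsto_pow_atTop_atTop_of_one_lt hlam)).atTop_div_const
      (by linarith)
  have hsum := (ho.sum_range (fun n => by positivity) hS).tendsto_div_nhds_zero
  have := (hsum.mul hg).add (hg.const_mul A)
  rw [zero_mul, zero_add, mul_one_div] at this
  refine this.congr' ?_
  filter_upwards [eventually_gt_atTop 0] with n hn
  have h1 : lam ^ n ≠ 0 := by positivity
  have h2 : ∑ i ∈ Finset.range n, lam ^ i ≠ 0 :=
    (Finset.sum_pos (fun i _ => by positivity) ⟨0, Finset.mem_range.2 hn⟩).ne'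
  rw [div_mul_div_cancel₀ h2, Finset.sum_sub_distrib, ← Finset.mul_sum]
  field_simp
  ring

lemma sum_range_one_div_sub {m D : ℕ} (h : m ≤ D) :
    ∑ j ∈ Finset.range m, 1 / ((D - j : ℕ) : ℝ) = (harmonic D : ℝ) - harmonic (D - m) := by
  induction m with
  | zero => simp
  | succ m ih =>
    rw [Finset.sum_range_succ, ih (by omega)]
    obtain ⟨d, rfl⟩ := Nat.exists_eq_add_of_le h
    rw [show m + 1 + d - m = d + 1 by omega, show m + 1 + d - (m + 1) = d by omega, harmonic_succ]
    push_cast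
    ring

lemma tendsto_atTop_of_tendsto_div_pow {lam L : ℝ} (hlam : 1 < lam) (hL : 0 < L) {p : ℕ → ℕ}
    (hp : Tendsto (fun n => (p n : ℝ) / lam ^ n) atTop (𝓝 L)) : Tendsto p atTop atTop := by
  have := hp.pos_mul_atTop hL (tendsto_pow_atTop_atTop_of_one_lt hlam)
  rw [← tendsto_natCast_atTop_iff (R := ℝ)]
  refine this.congr fun n => ?_
  have : lam ^ n ≠ 0 := by positivity
  field_simp

lemma tendsto_sum_one_div_sub {m D : ℕ → ℕ} (hmD : ∀ n, m n ≤ D n) {lam P Q : ℝ} (hlam : 1 < lam)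
    (hP : 0 < P) (hQ : 0 < Q) (hD : Tendsto (fun n => (D n : ℝ) / lam ^ n) atTop (𝓝 P))
    (hDm : Tendsto (fun n => ((D n - m n : ℕ) : ℝ) / lam ^ n) atTop (𝓝 Q)) :
    Tendsto (fun n => ∑ j ∈ Finset.range (m n), 1 / ((D n - j : ℕ) : ℝ)) atTop
      (𝓝 (Real.log (P / Q))) := by
  have h1 := Real.tendsto_harmonic_sub_log.comp (tendsto_atTop_of_tendsto_div_pow hlam hP hD)
  have h2 := Real.tendsto_harmonic_sub_log.comp (tendsto_atTop_of_tendsto_div_pow hlam hQ hDm)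
  have h3 := (hD.div hDm hQ.ne').log (div_pos hP hQ).ne'
  have := (h1.sub h2).add h3
  rw [sub_self, zero_add] at this
  refine this.congr' ?_
  filter_upwards [(tendsto_atTop_of_tendsto_div_pow hlam hP hD).eventually_gt_atTop 0,
    (tendsto_atTop_of_tendsto_div_pow hlam hQ hDm).eventually_gt_atTop 0] with n hn1 hn2
  have h4 : lam ^ n ≠ 0 := by positivity
  rw [sum_range_one_div_sub (hmD n)]
  simp only [Function.comp_apply, Pi.div_apply]
  rw [div_div_div_cancel_right₀ h4, Real.log_div (by positivity) (by positivity)]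
  ring

lemma vcoef_of_add {k l p : ℕ} (h : l + p + 1 = k) (lam : ℝ) :
    vcoef k lam l = (∑ j ∈ Finset.range (p + 1), lam ^ j) / lam ^ p := by
  rw [vcoef, show k - l = p + 1 by omega, show k - 1 - l = p by omega]

lemma one_le_vcoef {k l : ℕ} (h : l < k) {lam : ℝ} (hlam : 1 < lam) : 1 ≤ vcoef k lam l := by
  have hl0 : 0 < lam := by linarith
  rw [vcoef_of_add (show l + (k - 1 - l) + 1 = k by omega), one_le_div (by positivity)]
  exact Finset.single_le_sum (f := fun j => lam ^ j) (fun j _ => by positivity)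
    (Finset.self_mem_range_succ _)

lemma vcoef_zero {k : ℕ} (hk : 0 < k) {lam : ℝ} (hlam : 1 < lam)
    (hroot : lam ^ k = ∑ j ∈ Finset.range k, lam ^ j) : vcoef k lam 0 = lam := by
  obtain ⟨p, rfl⟩ : ∃ p, k = p + 1 := ⟨k - 1, by omega⟩
  have hl0 : 0 < lam := by linarith
  rw [vcoef_of_add (show 0 + p + 1 = p + 1 by omega), ← hroot, pow_succ]
  field_simp

lemma vcoef_le {k l : ℕ} (h : l < k) {lam : ℝ} (hlam : 1 < lam)
    (hroot : lam ^ k = ∑ j ∈ Finset.range k, lam ^ j) : vcoef k lam l ≤ lam := by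
  have hl0 : 0 < lam := by linarith
  have hmono : Monotone fun p : ℕ => (∑ j ∈ Finset.range (p + 1), lam ^ j) / lam ^ p := by
    refine monotone_nat_of_le_succ fun p => ?_
    rw [Finset.sum_range_succ' _ (p + 1), pow_zero]
    simp_rw [pow_succ lam]
    rw [← Finset.sum_mul, add_div, mul_div_mul_right _ _ hl0.ne']
    exact le_add_of_nonneg_right (by positivity)
  have hv := vcoef_of_add (show l + (k - 1 - l) + 1 = k by omega) lam
  have hv0 := vcoef_of_add (show 0 + (k - 1) + 1 = k by omega) lam
  rw [vcoef_zero (by omega) hlam hroot] at hv0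
  calc vcoef k lam l ≤ _ := hv.trans_le (hmono (show k - 1 - l ≤ k - 1 by omega))
    _ = lam := hv0.symm

variable {k : ℕ}

lemma tendsto_word_length {lam c : ℝ}
    (hc : ∀ a : Fin k,
      Tendsto (fun n => ((sWord^[n] [a]).length : ℝ) / lam ^ n) atTop (𝓝 (c * vcoef k lam a)))
    (w : List (Fin k)) :
    Tendsto (fun n => ((sWord^[n] w).length : ℝ) / lam ^ n) atTop
      (𝓝 (c * ∑ l : Fin k, vcoef k lam (l : ℕ) * (w.count l : ℝ))) := by
  induction w with
  | nil =>
    have : ∀ n, sWord^[n] ([] : List (Fin k)) = [] := fun n =>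
      Function.iterate_fixed sWord_nil n
    simp [this]
  | cons a w ih =>
    have hsum : c * ∑ l : Fin k, vcoef k lam (l : ℕ) * ((a :: w).count l : ℝ)
        = c * vcoef k lam a + c * ∑ l : Fin k, vcoef k lam (l : ℕ) * (w.count l : ℝ) := by
      simp [List.count_cons, mul_add, Finset.sum_add_distrib, add_comm]
    rw [hsum]
    refine ((hc a).add ih).congr fun n => ?_
    rw [← List.singleton_append (l := w), iterate_sWord_append, List.length_append]
    push_cast
    ring

variable [NeZero k]

lemma mul_vcoef (a : Fin k) {lam : ℝ} (hlam : 1 < lam) :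
    lam * vcoef k lam a
      = lam + if nextLetter a = 0 then 0 else vcoef k lam (nextLetter a : ℕ) := by
  have hl0 : 0 < lam := by linarith
  have ha := a.isLt
  unfold nextLetter
  split_ifs with h1 h2 h2
  · exact absurd (congrArg Fin.val h2) (by rw [Fin.val_zero]; exact Nat.succ_ne_zero _)
  · rw [vcoef_of_add (show (a : ℕ) + (k - 2 - a + 1) + 1 = k by omega),
      vcoef_of_add (show (a : ℕ) + 1 + (k - 2 - a) + 1 = k by omega), Finset.sum_range_succ,
      pow_succ]
    field_simp
    ring
  · rw [vcoef_of_add (p := 0) (show (a : ℕ) + 0 + 1 = k by omega)]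
    simp
  · exact absurd rfl h2

lemma iterate_sWord_letter_length_succ (n : ℕ) (a : Fin k) :
    (sWord^[n + 1] [a]).length
      = (sWord^[n] [(0 : Fin k)]).length
        + if nextLetter a = 0 then 0 else (sWord^[n] [nextLetter a]).length := by
  rw [Function.iterate_succ_apply, sWord_singleton, sLetter_eq]
  split_ifs
  · simp
  · rw [show [0, nextLetter a] = [0] ++ [nextLetter a] from rfl, iterate_sWord_append,
      List.length_append]

lemma exists_tendsto_letter_length {lam : ℝ} (hlam : 1 < lam)
    (hroot : lam ^ k = ∑ j ∈ Finset.range k, lam ^ j) :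
    ∃ c, 0 < c ∧ ∀ a : Fin k,
      Tendsto (fun n => ((sWord^[n] [a]).length : ℝ) / lam ^ n) atTop (𝓝 (c * vcoef k lam a)) := by
  have hl0 : 0 < lam := by linarith
  have hv : ∀ a : Fin k, 1 ≤ vcoef k lam a := fun a => one_le_vcoef a.isLt hlam
  have hv0 : vcoef k lam ((0 : Fin k) : ℕ) = lam := by
    rw [Fin.val_zero, vcoef_zero (Nat.pos_of_neZero k) hlam hroot]
  obtain ⟨c, hc, hlim⟩ := exists_common_limit
    (fun n (a : Fin k) => ((sWord^[n] [a]).length : ℝ) / (vcoef k lam a * lam ^ n)) nextLetter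
    (fun a => 1 / vcoef k lam a) 0 (1 / lam) (by positivity)
    (fun a => one_div_le_one_div_of_le (by linarith [hv a]) (vcoef_le a.isLt hlam hroot))
    (fun a => by rw [div_le_one (by linarith [hv a])]; exact hv a)
    (fun a => by simp)
    (fun n a => by
      have h1 : vcoef k lam a ≠ 0 := by linarith [hv a]
      have h2 : vcoef k lam (nextLetter a : ℕ) ≠ 0 := by linarith [hv (nextLetter a)]
      have h3 := mul_vcoef a hlam
      have h4 : lam ^ n ≠ 0 := by positivity
      rw [hv0, iterate_sWord_letter_length_succ, pow_succ]
      split_ifs at h3 ⊢ with h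
      · have h5 : vcoef k lam a = 1 := by
          apply mul_left_cancel₀ hl0.ne'
          linarith
        rw [h5]
        push_cast
        field_simp
        ring
      · have h5 : 1 - 1 / vcoef k lam a
            = vcoef k lam (nextLetter a : ℕ) / (lam * vcoef k lam a) := by
          field_simp
          linarith
        rw [h5]
        push_cast
        field_simp)
  refine ⟨c, hc, fun a => ((hlim a).mul_const (vcoef k lam a)).congr fun n => ?_⟩
  have h1 : vcoef k lam a ≠ 0 := by linarith [hv a]
  field_simp

lemma zeroTail_length (n : ℕ) :
    (zeroTail k n).length = ∑ i ∈ Finset.range n, (sWord^[i] [(0 : Fin k)]).length := by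
  induction n with
  | zero => rfl
  | succ n ih => rw [zeroTail, List.length_append, Finset.sum_range_succ, ih, Nat.add_comm]

lemma tendsto_imagePrefix_length {lam c : ℝ} (hlam : 1 < lam)
    (hroot : lam ^ k = ∑ j ∈ Finset.range k, lam ^ j)
    (hc : ∀ a : Fin k,
      Tendsto (fun n => ((sWord^[n] [a]).length : ℝ) / lam ^ n) atTop (𝓝 (c * vcoef k lam a)))
    (w : List (Fin k)) :
    Tendsto (fun n => ((imagePrefix w n).length : ℝ) / lam ^ n) atTop
      (𝓝 (c * (lam / (lam - 1) + ∑ l : Fin k, vcoef k lam (l : ℕ) * (w.count l : ℝ)))) := by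
  have h := (tendsto_sum_div_pow hlam (hc 0)).add (tendsto_word_length hc w)
  rw [Fin.val_zero, vcoef_zero (Nat.pos_of_neZero k) hlam hroot, mul_div_assoc, ← mul_add] at h
  refine h.congr fun n => ?_
  rw [imagePrefix, List.length_append, zeroTail_length]
  push_cast
  ring

end Growth

section Equidistribution

open Filter Topology MeasureTheory

variable {k : ℕ}

lemma continuous_shift : Continuous (shift : (ℕ → Fin k) → ℕ → Fin k) :=
  continuous_pi fun n => continuous_apply (n + 1)

lemma isClopen_lang_pref (N : ℕ) : IsClopen {y : ℕ → Fin k | Lang (pref y N)} := by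
  have hc : Continuous fun (y : ℕ → Fin k) (i : Fin N) => y i :=
    continuous_pi fun i => continuous_apply (i : ℕ)
  convert (isClopen_discrete {z : Fin N → Fin k | Lang (List.ofFn z)}).preimage hc using 1
  ext y
  have : pref y N = List.ofFn fun i : Fin N => y i :=
    List.ext_getElem (by simp [pref]) (by simp [pref])
  simp [this]

lemma measurableSet_attr : MeasurableSet (Attr k) := by
  have : Attr k = ⋂ i, ⋂ n, shift^[i] ⁻¹' {y : ℕ → Fin k | Lang (pref y n)} := by
    ext x
    simp [Attr, pref_shift_iterate]
  rw [this]
  exact MeasurableSet.iInter fun i => MeasurableSet.iInter fun n =>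
    ((isClopen_lang_pref n).preimage (continuous_shift.iterate i)).isOpen.measurableSet

lemma tendsto_integral_of_tendsto {ι : Type*} {l : Filter ι}
    {ν : ι → ProbabilityMeasure (ℕ → Fin k)} {ρ : ProbabilityMeasure (ℕ → Fin k)}
    (h : Tendsto ν l (𝓝 ρ)) {f : (ℕ → Fin k) → ℝ} (hf : Continuous f) :
    Tendsto (fun n => ∫ y, f y ∂(ν n : Measure (ℕ → Fin k))) l
      (𝓝 (∫ y, f y ∂(ρ : Measure (ℕ → Fin k)))) :=
  ((ProbabilityMeasure.continuous_integral_continuousMap (⟨f, hf⟩ : C(ℕ → Fin k, ℝ))).tendsto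
    ρ).comp h

/-- Asymptotically invariant measures concentrating on the subshift converge to its unique
invariant measure. -/
lemma tendsto_of_asymptotically_invariant (μ : ProbabilityMeasure (ℕ → Fin k))
    (hμuniq : ∀ ν : Measure (ℕ → Fin k), IsProbabilityMeasure ν →
      ν (Attr k) = 1 → Measure.map shift ν = ν → ν = μ)
    (ν : ℕ → ProbabilityMeasure (ℕ → Fin k))
    (hinv : ∀ f : (ℕ → Fin k) → ℝ, Continuous f →
      Tendsto (fun n => ∫ y, f (shift y) ∂(ν n : Measure (ℕ → Fin k))
        - ∫ y, f y ∂(ν n : Measure (ℕ → Fin k))) atTop (𝓝 0))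
    (hsupp : ∀ N, ∀ᶠ n in atTop, (ν n : Measure (ℕ → Fin k)) {y | Lang (pref y N)} = 1) :
    Tendsto ν atTop (𝓝 μ) := by
  refine tendsto_nhds_of_unique_mapClusterPt fun ρ hρ => ?_
  obtain ⟨U, hU, hlim⟩ := mapClusterPt_iff_ultrafilter.1 hρ
  refine Subtype.ext (hμuniq ρ inferInstance ?_ ?_)
  · have hN : ∀ N, ∀ᵐ y ∂(ρ : Measure (ℕ → Fin k)), Lang (pref y N) := by
      intro N
      have hcl := isClopen_lang_pref (k := k) N
      have h1 := ProbabilityMeasure.tendsto_measure_of_null_frontier_of_tendsto' hlim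
        (E := {y | Lang (pref y N)}) (by rw [hcl.frontier_eq]; exact measure_empty)
      have h2 : Tendsto (fun n => (ν n : Measure (ℕ → Fin k)) {y | Lang (pref y N)}) U (𝓝 1) :=
        tendsto_const_nhds.congr' (((hsupp N).filter_mono hU).mono fun n hn => hn.symm)
      exact (mem_ae_iff_prob_eq_one hcl.isOpen.measurableSet).2 (tendsto_nhds_unique h1 h2)
    rw [← mem_ae_iff_prob_eq_one measurableSet_attr]
    filter_upwards [ae_all_iff.2 hN] with y hy
    by_contra hcon
    obtain ⟨n, hn⟩ := exists_isDelta hcon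
    exact hn.2 (hy _)
  · have : IsProbabilityMeasure (Measure.map shift (ρ : Measure (ℕ → Fin k))) :=
      Measure.isProbabilityMeasure_map continuous_shift.aemeasurable
    refine ext_of_forall_integral_eq_of_IsFiniteMeasure fun f => ?_
    rw [integral_map continuous_shift.aemeasurable f.continuous.aestronglyMeasurable]
    have h1 := tendsto_integral_of_tendsto hlim (f.continuous.comp continuous_shift)
    have h2 := tendsto_integral_of_tendsto hlim f.continuous
    exact sub_eq_zero.1 (tendsto_nhds_unique (h1.sub h2) ((hinv f f.continuous).mono_left hU))

/-- The measure giving mass `w j` to the `j`-th point of the orbit segment of length `m`. -/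
noncomputable def orbitMeasure (y : ℕ → Fin k) (m : ℕ) (w : ℕ → ℝ) : Measure (ℕ → Fin k) :=
  ∑ j ∈ Finset.range m, ENNReal.ofReal (w j) • Measure.dirac (shift^[j] y)

lemma isProbabilityMeasure_orbitMeasure (y : ℕ → Fin k) {m : ℕ} {w : ℕ → ℝ}
    (hw : ∀ j < m, 0 ≤ w j) (hsum : ∑ j ∈ Finset.range m, w j = 1) :
    IsProbabilityMeasure (orbitMeasure y m w) := by
  constructor
  rw [orbitMeasure, Measure.coe_finsetSum, Finset.sum_apply]
  simp only [Measure.smul_apply, measure_univ, smul_eq_mul, mul_one]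
  rw [← ENNReal.ofReal_sum_of_nonneg fun j hj => hw j (Finset.mem_range.1 hj), hsum,
    ENNReal.ofReal_one]

lemma integral_orbitMeasure (y : ℕ → Fin k) {m : ℕ} {w : ℕ → ℝ} (hw : ∀ j < m, 0 ≤ w j)
    {f : (ℕ → Fin k) → ℝ} (hf : Continuous f) :
    ∫ z, f z ∂orbitMeasure y m w = ∑ j ∈ Finset.range m, w j * f (shift^[j] y) := by
  rw [orbitMeasure, integral_finsetSum_measure]
  · refine Finset.sum_congr rfl fun j hj => ?_
    rw [integral_smul_measure, integral_dirac,
      ENNReal.toReal_ofReal (hw j (Finset.mem_range.1 hj)), smul_eq_mul]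
  · intro j _
    exact (hf.integrable_of_hasCompactSupport (HasCompactSupport.of_compactSpace f)).smul_measure
      ENNReal.ofReal_ne_top

lemma orbitMeasure_eq_zero (y : ℕ → Fin k) {m : ℕ} (w : ℕ → ℝ) {E : Set (ℕ → Fin k)}
    (hE : MeasurableSet E) (h : ∀ j < m, shift^[j] y ∉ E) : orbitMeasure y m w E = 0 := by
  rw [orbitMeasure, Measure.coe_finsetSum, Finset.sum_apply]
  refine Finset.sum_eq_zero fun j hj => ?_
  simp [Measure.dirac_apply' _ hE, h j (Finset.mem_range.1 hj)]

/-- Abel summation against monotone weights. -/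
lemma abs_sum_mul_sub_le {w F : ℕ → ℝ} {B : ℝ} (hB : ∀ j, |F j| ≤ B) {m : ℕ} (h0 : 0 ≤ w 0)
    (hmono : ∀ j < m, w j ≤ w (j + 1)) :
    |∑ j ∈ Finset.range m, w j * (F (j + 1) - F j)| ≤ 2 * B * w m := by
  have key : |∑ j ∈ Finset.range m, w j * (F (j + 1) - F j) - w m * F m| ≤ B * w m ∧ 0 ≤ w m := by
    induction m with
    | zero =>
      refine ⟨?_, h0⟩
      rw [Finset.sum_range_zero, zero_sub, abs_neg, abs_mul, abs_of_nonneg h0, mul_comm]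
      exact mul_le_mul_of_nonneg_right (hB 0) h0
    | succ m ih =>
      obtain ⟨h1, h2⟩ := ih fun j hj => hmono j (by omega)
      have h3 := hmono m (by omega)
      refine ⟨?_, h2.trans h3⟩
      rw [Finset.sum_range_succ, show ∀ s : ℝ, s + w m * (F (m + 1) - F m) - w (m + 1) * F (m + 1)
        = (s - w m * F m) - (w (m + 1) - w m) * F (m + 1) from fun s => by ring]
      refine (abs_sub _ _).trans ?_
      rw [abs_mul, abs_of_nonneg (sub_nonneg.2 h3)]
      nlinarith [mul_le_mul_of_nonneg_left (hB (m + 1)) (sub_nonneg.2 h3)]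
  obtain ⟨h1, h2⟩ := key
  have h4 : |w m * F m| ≤ w m * B := by
    rw [abs_mul, abs_of_nonneg h2]
    exact mul_le_mul_of_nonneg_left (hB m) h2
  calc _ = |(∑ j ∈ Finset.range m, w j * (F (j + 1) - F j) - w m * F m) + w m * F m| := by
        rw [sub_add_cancel]
    _ ≤ _ := abs_add_le _ _
    _ ≤ 2 * B * w m := by linarith

lemma tendsto_weighted_orbit_sum (μ : Measure (ℕ → Fin k)) [IsProbabilityMeasure μ]
    (hμuniq : ∀ ν : Measure (ℕ → Fin k), IsProbabilityMeasure ν →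
      ν (Attr k) = 1 → Measure.map shift ν = ν → ν = μ)
    {f : (ℕ → Fin k) → ℝ} (hf : Continuous f) (y : ℕ → ℕ → Fin k) {m D : ℕ → ℕ} {L : ℝ}
    (hm : ∀ n, 0 < m n) (hmD : ∀ n, m n < D n)
    (hgap : Tendsto (fun n => D n - m n) atTop atTop) (hL : 0 < L)
    (hsum : Tendsto (fun n => ∑ j ∈ Finset.range (m n), 1 / ((D n - j : ℕ) : ℝ)) atTop (𝓝 L))
    (hlang : ∀ n, ∀ j < m n, Lang (pref (shift^[j] (y n)) (D n - j))) :
    Tendsto (fun n => ∑ j ∈ Finset.range (m n), f (shift^[j] (y n)) / ((D n - j : ℕ) : ℝ)) atTop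
      (𝓝 ((∫ z, f z ∂μ) * L)) := by
  set Z : ℕ → ℝ := fun n => ∑ j ∈ Finset.range (m n), 1 / ((D n - j : ℕ) : ℝ) with hZ
  have hwpos : ∀ n, ∀ j ≤ m n, 0 < 1 / ((D n - j : ℕ) : ℝ) := fun n j hj => by
    have h1 := hmD n
    have h2 : 0 < D n - j := by omega
    positivity
  have hZpos : ∀ n, 0 < Z n := fun n =>
    Finset.sum_pos (fun j hj => hwpos n j (Finset.mem_range.1 hj).le) ⟨0, Finset.mem_range.2 (hm n)⟩
  set w : ℕ → ℕ → ℝ := fun n j => 1 / ((D n - j : ℕ) : ℝ) / Z n with hw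
  have hwnn : ∀ n, ∀ j < m n, 0 ≤ w n j := fun n j hj =>
    (div_pos (hwpos n j hj.le) (hZpos n)).le
  have hprob : ∀ n, IsProbabilityMeasure (orbitMeasure (y n) (m n) (w n)) := fun n =>
    isProbabilityMeasure_orbitMeasure _ (hwnn n)
      (by rw [hw, ← Finset.sum_div]; exact div_self (hZpos n).ne')
  set ν : ℕ → ProbabilityMeasure (ℕ → Fin k) := fun n => ⟨_, hprob n⟩ with hν
  have hlim : Tendsto ν atTop (𝓝 ⟨μ, inferInstance⟩) := by
    refine tendsto_of_asymptotically_invariant _ hμuniq ν (fun F hF => ?_) fun N => ?_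
    · obtain ⟨B, hB⟩ : ∃ B, ∀ z, |F z| ≤ B := by
        obtain ⟨B, hB⟩ := isCompact_univ.exists_bound_of_continuousOn hF.continuousOn
        exact ⟨B, fun z => hB z (Set.mem_univ z)⟩
      have hw0 : Tendsto (fun n => 2 * B * w n (m n)) atTop (𝓝 0) := by
        have h1 : Tendsto (fun n => 1 / ((D n - m n : ℕ) : ℝ)) atTop (𝓝 0) :=
          tendsto_one_div_atTop_nhds_zero_nat.comp hgap
        have := (h1.div hsum hL.ne').const_mul (2 * B)
        rw [zero_div, mul_zero] at this
        exact this
      refine squeeze_zero_norm (fun n => ?_) hw0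
      have h1 : ∫ z, F (shift z) ∂(ν n : Measure (ℕ → Fin k))
          = ∑ j ∈ Finset.range (m n), w n j * F (shift (shift^[j] (y n))) :=
        integral_orbitMeasure (y n) (hwnn n) (hF.comp continuous_shift)
      have h2 : ∫ z, F z ∂(ν n : Measure (ℕ → Fin k))
          = ∑ j ∈ Finset.range (m n), w n j * F (shift^[j] (y n)) :=
        integral_orbitMeasure (y n) (hwnn n) hF
      rw [h1, h2, ← Finset.sum_sub_distrib, Real.norm_eq_abs]
      have h3 := abs_sum_mul_sub_le (w := w n) (F := fun j => F (shift^[j] (y n))) (B := B)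
        (m := m n) (fun j => hB _) (hwnn n 0 (hm n)) fun j hj => by
          have h4 := hwpos n (j + 1) hj
          have h5 := hmD n
          refine div_le_div_of_nonneg_right (one_div_le_one_div_of_le ?_ ?_) (hZpos n).le
          · exact_mod_cast (show 0 < D n - (j + 1) by omega)
          · exact_mod_cast (show D n - (j + 1) ≤ D n - j by omega)
      simpa only [Function.iterate_succ_apply', mul_sub] using h3
    · filter_upwards [hgap.eventually_ge_atTop N] with n hn
      have hcl := isClopen_lang_pref (k := k) N
      rw [← prob_compl_eq_zero_iff hcl.isOpen.measurableSet]
      refine orbitMeasure_eq_zero _ _ hcl.isOpen.measurableSet.compl fun j hj hcon => ?_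
      exact hcon ((hlang n j hj).of_infix (pref_prefix _ (by omega)).isInfix)
  refine ((tendsto_integral_of_tendsto hlim hf).mul hsum).congr fun n => ?_
  have h1 : ∫ z, f z ∂(ν n : Measure (ℕ → Fin k))
      = ∑ j ∈ Finset.range (m n), w n j * f (shift^[j] (y n)) :=
    integral_orbitMeasure (y n) (hwnn n) hf
  rw [h1, Finset.sum_mul]
  refine Finset.sum_congr rfl fun j _ => ?_
  have := (hZpos n).ne'
  simp only [hw]
  field_simp

end Equidistribution

open MeasureTheory in
theorem stmt9 (k : ℕ) (hk : 2 ≤ k) (lam : ℝ) (hlam : 1 < lam)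
    (hroot : lam ^ k = ∑ j ∈ Finset.range k, lam ^ j)
    (μ : Measure (ℕ → Fin k)) [IsProbabilityMeasure μ]
    (hμsupp : μ (Attr k) = 1)
    (hμinv : Measure.map shift μ = μ)
    (hμuniq : ∀ ν : Measure (ℕ → Fin k), IsProbabilityMeasure ν →
      ν (Attr k) = 1 → Measure.map shift ν = ν → ν = μ)
    (g h : (ℕ → Fin k) → ℝ) (hg : Continuous g) (hgpos : ∀ x, 0 < g x)
    (hh : Continuous h) (hh0 : ∀ x ∈ Attr k, h x = 0)
    (V : (ℕ → Fin k) → ℝ)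
    (hV : ∀ x, V x = if delta x = ⊤ then 0 else (g x + h x) / ((delta x).toNat : ℝ))
    (hVnn : ∀ x, 0 ≤ V x)
    (x : ℕ → Fin k) (hx : x ∉ Attr k) :
    Filter.Tendsto (fun n => (Renorm^[n] V) x) Filter.atTop
      (nhds ((∫ y, g y ∂μ) * Ufix k lam x)) := by
  have : NeZero k := ⟨by omega⟩
  obtain ⟨N, hN⟩ := exists_isDelta hx
  obtain ⟨c, hc, hlet⟩ := exists_tendsto_letter_length (k := k) hlam hroot
  obtain ⟨w, hw⟩ := exists_pref_eq_cons x hN.pos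
  set T := lam / (lam - 1) + ∑ l : Fin k, vcoef k lam (l : ℕ) * ((pref x N).count l : ℝ) with hT
  set v := vcoef k lam (x 0) with hv
  have hv1 : 1 ≤ v := one_le_vcoef (x 0).isLt hlam
  have hvpos : ∀ l : Fin k, 0 ≤ vcoef k lam l := fun l =>
    zero_le_one.trans (one_le_vcoef l.isLt hlam)
  have hTv : 0 < T - v := by
    have h1 : v * ((pref x N).count (x 0) : ℝ)
        ≤ ∑ l : Fin k, vcoef k lam (l : ℕ) * ((pref x N).count l : ℝ) :=
      Finset.single_le_sum (f := fun l : Fin k => vcoef k lam (l : ℕ) * ((pref x N).count l : ℝ))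
        (fun l _ => mul_nonneg (hvpos l) (Nat.cast_nonneg _)) (Finset.mem_univ (x 0))
    have h2 : (1 : ℝ) ≤ (pref x N).count (x 0) := by
      exact_mod_cast List.count_pos_iff.2 (by rw [hw]; exact List.mem_cons_self)
    have h3 : 0 < lam / (lam - 1) := div_pos (by linarith) (by linarith)
    nlinarith
  have hU : Ufix k lam x = Real.log ((c * T) / (c * (T - v))) := by
    rw [Ufix, hN.delta_eq, if_neg (ENat.natCast_ne_top N), ENat.toNat_natCast, ← hT, ← hv,
      mul_div_mul_left _ _ hc.ne']
    congr 1
    field_simp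
    ring
  have hUpos : 0 < Ufix k lam x := by
    rw [hU, mul_div_mul_left _ _ hc.ne']
    exact Real.log_pos ((one_lt_div hTv).2 (by linarith))
  have hle : ∀ n, (sWord^[n] [x 0]).length + (zeroTail k n).length
      ≤ (imagePrefix (pref x N) n).length := fun n => by
    rw [hw]
    exact letter_length_le_imagePrefix_length w (x 0) n
  have hD := tendsto_imagePrefix_length hlam hroot hlet (pref x N)
  have hsub : ∀ n, (((imagePrefix (pref x N) n).length - (sWord^[n] [x 0]).length : ℕ) : ℝ)
      = (imagePrefix (pref x N) n).length - (sWord^[n] [x 0]).length := fun n =>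
    Nat.cast_sub ((Nat.le_add_right _ _).trans (hle n))
  have hDm : Filter.Tendsto (fun n =>
      (((imagePrefix (pref x N) n).length - (sWord^[n] [x 0]).length : ℕ) : ℝ) / lam ^ n)
      Filter.atTop (nhds (c * (T - v))) := by
    have h1 := hD.sub (hlet (x 0))
    rw [← hT, ← hv, ← mul_sub] at h1
    refine h1.congr fun n => ?_
    rw [hsub, sub_div]
  have hsum := tendsto_sum_one_div_sub (fun n => (Nat.le_add_right _ _).trans (hle n)) hlam
    (mul_pos hc (by linarith)) (mul_pos hc hTv) hD hDm
  rw [← hU] at hsum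
  have hgap := tendsto_atTop_of_tendsto_div_pow hlam (mul_pos hc hTv) hDm
  have hint : ∫ y, (g + h) y ∂μ = ∫ y, g y ∂μ := by
    refine integral_congr_ae ?_
    filter_upwards [(mem_ae_iff_prob_eq_one measurableSet_attr).2 hμsupp] with y hy
    rw [Pi.add_apply, hh0 y hy, add_zero]
  have hmain := tendsto_weighted_orbit_sum μ hμuniq (hg.add hh) (fun n => sSeq^[n + 1] x)
    (m := fun n => (sWord^[n + 1] [x 0]).length)
    (D := fun n => (imagePrefix (pref x N) (n + 1)).length)
    (fun n => List.length_pos_iff.2 (iterate_sWord_ne_nil _ (by simp)))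
    (fun n => by
      have h1 : 0 < (sWord^[n] [(0 : Fin k)]).length :=
        List.length_pos_iff.2 (iterate_sWord_ne_nil _ (by simp))
      have h2 := hle (n + 1)
      rw [zeroTail, List.length_append] at h2
      omega)
    ((Filter.tendsto_add_atTop_iff_nat 1).2 hgap) hUpos
    ((Filter.tendsto_add_atTop_iff_nat 1).2 hsum)
    (fun n j hj => (hN.iterate_sSeq_shift hk (n + 1) hj).1)
  rw [hint] at hmain
  rw [← Filter.tendsto_add_atTop_iff_nat 1]
  refine hmain.congr fun n => ?_
  rw [iterate_renorm]
  refine Finset.sum_congr rfl fun j hj => ?_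
  rw [hV, (hN.iterate_sSeq_shift hk (n + 1) (Finset.mem_range.1 hj)).delta_eq,
    if_neg (ENat.natCast_ne_top _), ENat.toNat_natCast, Pi.add_apply]
end

section
/- Let a > 0 and λ > 1 be real numbers, and let f be a Lipschitz function defined on an open neighborhood of the interval [0, a]. Let φ : ℕ → ℝ satisfy |φ(n)| ≤ C θ^n for all n, for some C > 0 and 0 < θ < λ. Then lim_{n→∞} (1/λ^n) Σ_{j=0}^{⌊a λ^n⌋} f((j + φ(n))/λ^n) = ∫_0^a f(x) dx. -/
/-- Error bound for shifted Riemann sums of mesh `1 / N` of a Lipschitz function. -/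
theorem LipschitzWith.abs_riemannSum_sub_integral_le {K : NNReal} {g : ℝ → ℝ}
    (hg : LipschitzWith K g) {N : ℝ} (hN : 0 < N) (s : ℝ) (m : ℕ) :
    |(1 / N) * ∑ j ∈ Finset.range m, g ((j + s) / N) - ∫ x in (0 : ℝ)..(m / N), g x|
      ≤ (m / N) * (K * ((1 + |s|) / N)) := by
  have hint : ∀ u v : ℝ, IntervalIntegrable g MeasureTheory.volume u v :=
    fun u v => hg.continuous.intervalIntegrable u v
  induction m with
  | zero => simp
  | succ m ih =>
    have hlen : ((m + 1 : ℕ) : ℝ) / N - m / N = 1 / N := by push_cast; ring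
    have hcell : |(1 / N) * g ((m + s) / N) - ∫ x in (m / N : ℝ)..((m + 1 : ℕ) / N), g x|
        ≤ (1 / N) * (K * ((1 + |s|) / N)) := by
      have hconst : (1 / N) * g ((m + s) / N)
          = ∫ _ in (m / N : ℝ)..((m + 1 : ℕ) / N), g ((m + s) / N) := by
        rw [intervalIntegral.integral_const, hlen, smul_eq_mul]
      rw [hconst, ← intervalIntegral.integral_sub (by simp) (hint _ _), ← Real.norm_eq_abs]
      refine (intervalIntegral.norm_integral_le_of_norm_le_const
        (C := K * ((1 + |s|) / N)) fun x hx => ?_).trans_eq ?_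
      · rw [Set.uIoc_of_le (by have := one_div_pos.2 hN; linarith)] at hx
        rw [← dist_eq_norm]
        refine (hg.dist_le_mul _ _).trans ?_
        gcongr
        have hx' : |x - m / N| ≤ 1 / N := by
          rw [abs_le]
          have := one_div_pos.2 hN
          constructor <;> linarith [hx.1, hx.2]
        calc dist ((m + s) / N) x = |s / N - (x - m / N)| := by
              rw [Real.dist_eq]; congr 1; ring
          _ ≤ |s / N| + |x - m / N| := abs_sub _ _
          _ ≤ |s| / N + 1 / N := by rw [abs_div, abs_of_pos hN]; gcongr
          _ = (1 + |s|) / N := by ring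
      · rw [hlen, abs_of_pos (one_div_pos.2 hN), mul_comm]
    rw [Finset.sum_range_succ,
      ← intervalIntegral.integral_add_adjacent_intervals (hint 0 (m / N)) (hint _ _)]
    calc _ = |((1 / N) * ∑ j ∈ Finset.range m, g ((j + s) / N) - ∫ x in (0 : ℝ)..(m / N), g x)
          + ((1 / N) * g ((m + s) / N) - ∫ x in (m / N : ℝ)..((m + 1 : ℕ) / N), g x)| := by
          congr 1; ring
      _ ≤ _ := abs_add_le _ _
      _ ≤ (m / N) * (K * ((1 + |s|) / N)) + (1 / N) * (K * ((1 + |s|) / N)) :=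
          add_le_add ih hcell
      _ = _ := by push_cast; ring

theorem stmt12 (a lam : ℝ) (ha : 0 < a) (hlam : 1 < lam)
    (f : ℝ → ℝ) (U : Set ℝ) (hU : IsOpen U) (hUa : Set.Icc 0 a ⊆ U)
    (K : NNReal) (hf : LipschitzOnWith K f U)
    (φ : ℕ → ℝ) (C θ : ℝ) (hC : 0 < C) (hθ0 : 0 < θ) (hθlam : θ < lam)
    (hφ : ∀ n, |φ n| ≤ C * θ ^ n) :
    Filter.Tendsto
      (fun n : ℕ =>
        (1 / lam ^ n) * ∑ j ∈ Finset.range (⌊a * lam ^ n⌋₊ + 1), f ((j + φ n) / lam ^ n))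
      Filter.atTop (nhds (∫ x in (0:ℝ)..a, f x)) := by
  have hlam0 : 0 < lam := one_pos.trans hlam
  have hN : ∀ n : ℕ, 0 < lam ^ n := fun n => pow_pos hlam0 n
  obtain ⟨g, hg, hfg⟩ := hf.extend_real
  obtain ⟨δ, hδ, hδU⟩ := isCompact_Icc.exists_thickening_subset_open hU hUa
  have hinv : Filter.Tendsto (fun n : ℕ => 1 / lam ^ n) Filter.atTop (nhds 0) := by
    simpa [Function.comp_def] using
      tendsto_inv_atTop_zero.comp (tendsto_pow_atTop_atTop_of_one_lt hlam)
  have hshift : Filter.Tendsto (fun n : ℕ => |φ n| / lam ^ n) Filter.atTop (nhds 0) := by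
    have hgeom : Filter.Tendsto (fun n : ℕ => C * (θ / lam) ^ n) Filter.atTop (nhds 0) := by
      simpa using (tendsto_pow_atTop_nhds_zero_of_lt_one (by positivity)
        ((div_lt_one hlam0).2 hθlam)).const_mul C
    refine squeeze_zero (fun n => div_nonneg (abs_nonneg _) (hN n).le) (fun n => ?_) hgeom
    rw [div_pow, ← mul_div_assoc]
    exact div_le_div_of_nonneg_right (hφ n) (hN n).le
  have hend : Filter.Tendsto (fun n : ℕ => ((⌊a * lam ^ n⌋₊ + 1 : ℕ) : ℝ) / lam ^ n)
      Filter.atTop (nhds a) := by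
    refine tendsto_of_tendsto_of_tendsto_of_le_of_le tendsto_const_nhds
      (by simpa using hinv.const_add a) (fun n => ?_) (fun n => ?_)
    · rw [le_div_iff₀ (hN n)]
      push_cast
      exact (Nat.lt_floor_add_one _).le
    · have := Nat.floor_le (mul_nonneg ha.le (hN n).le)
      have hne := (hN n).ne'
      rw [div_le_iff₀ (hN n)]
      push_cast
      field_simp
      linarith
  have hintegral : Filter.Tendsto
      (fun n : ℕ => ∫ x in (0 : ℝ)..(((⌊a * lam ^ n⌋₊ + 1 : ℕ) : ℝ) / lam ^ n), g x)
      Filter.atTop (nhds (∫ x in (0 : ℝ)..a, g x)) :=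
    ((intervalIntegral.continuous_primitive
      (fun u v => hg.continuous.intervalIntegrable u v) 0).tendsto a).comp hend
  have herror : Filter.Tendsto
      (fun n : ℕ => (1 / lam ^ n) *
          ∑ j ∈ Finset.range (⌊a * lam ^ n⌋₊ + 1), g ((j + φ n) / lam ^ n)
        - ∫ x in (0 : ℝ)..(((⌊a * lam ^ n⌋₊ + 1 : ℕ) : ℝ) / lam ^ n), g x)
      Filter.atTop (nhds 0) := by
    refine squeeze_zero_norm (fun n => hg.abs_riemannSum_sub_integral_le (hN n) (φ n) _) ?_
    simpa [add_div] using hend.mul ((hinv.add hshift).const_mul (K : ℝ))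
  have hfg_integral : ∫ x in (0 : ℝ)..a, f x = ∫ x in (0 : ℝ)..a, g x :=
    intervalIntegral.integral_congr fun x hx =>
      hfg (hUa (by rwa [Set.uIcc_of_le ha.le] at hx))
  rw [hfg_integral]
  have hlim := herror.add hintegral
  simp only [sub_add_cancel, zero_add] at hlim
  refine hlim.congr' ?_
  filter_upwards [hshift.eventually_lt_const hδ] with n hn
  congr 1
  refine Finset.sum_congr rfl fun j hj => (hfg (hδU ?_)).symm
  have hj' : (j : ℝ) ≤ a * lam ^ n :=
    (Nat.le_floor_iff (mul_nonneg ha.le (hN n).le)).1 (Finset.mem_range_succ_iff.1 hj)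
  refine Metric.mem_thickening_iff.2 ⟨j / lam ^ n,
    ⟨div_nonneg j.cast_nonneg (hN n).le, (div_le_iff₀ (hN n)).2 hj'⟩, ?_⟩
  rwa [Real.dist_eq, add_div, add_sub_cancel_left, abs_div, abs_of_pos (hN n)]
end

section
/- Let k ≥ 2 be an integer and for each n ∈ ℕ let b_n = s_k^n(0) · s_k^{n−1}(0) · … · s_k(0) · 0 (for n = 0, b_0 = 0). Then lim_{m→∞} |b_m|/|b_{m+1}| = 1/λ. -/
open Filter Topology Finset Asymptotics

/-- Discrete summation by parts against the partial sums of `p`. -/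
theorem sum_partialSum_shift (p f : ℕ → ℝ) (k : ℕ) :
    ∑ i ∈ range k, (∑ j ∈ range (i + 1), p j) * f (i + 1) + ∑ i ∈ range k, p i * f i =
      ∑ i ∈ range k, (∑ j ∈ range (i + 1), p j) * f i + (∑ j ∈ range k, p j) * f k := by
  induction k with
  | zero => simp
  | succ k ih =>
    simp only [sum_range_succ _ k]
    linarith

/-- A nonnegative sequence each of whose terms is a fixed strictly positive weighted average of
the `k` preceding ones converges, to a positive limit if its first term is positive. -/
theorem exists_pos_tendsto_of_weighted_average {k : ℕ} (hk : 0 < k) {p x : ℕ → ℝ}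
    (hp : ∀ i, 0 < p i) (hp1 : ∑ i ∈ range k, p i = 1)
    (hx : ∀ n, x (n + k) = ∑ i ∈ range k, p i * x (n + i))
    (hx0 : ∀ n, 0 ≤ x n) (hpos : 0 < x 0) :
    ∃ c, 0 < c ∧ Tendsto x atTop (𝓝 c) := by
  set q : ℕ → ℝ := fun i => ∑ j ∈ range (i + 1), p j with hq
  have hqpos : ∀ i, 0 < q i := fun i => sum_pos (fun j _ => hp j) (by simp)
  have hne : (range k).Nonempty := by simpa using hk.ne'
  have hshift : ∀ (y : ℕ → ℝ) (n : ℕ), ∑ i ∈ range k, q i * y (n + 1 + i)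
      + ∑ i ∈ range k, p i * y (n + i) = ∑ i ∈ range k, q i * y (n + i) + y (n + k) := by
    intro y n
    have h := sum_partialSum_shift p (fun i => y (n + i)) k
    rw [hp1, one_mul] at h
    simpa only [hq, add_assoc, add_comm 1] using h
  have hW : ∀ n, ∑ i ∈ range k, q i * x (n + i) = ∑ i ∈ range k, q i * x i := by
    intro n
    induction n with
    | zero => simp
    | succ n ih =>
      have h := hshift x n
      rw [hx n] at h
      linarith
  set E : ℕ → ℝ := fun n => ∑ i ∈ range k, q i * x (n + i) ^ 2 with hE
  have hvar : ∀ n, E n - E (n + 1) = ∑ i ∈ range k, p i * (x (n + i) - x (n + k)) ^ 2 := by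
    intro n
    have h := hshift (fun m => x m ^ 2) n
    have h2 : ∑ i ∈ range k, p i * (x (n + i) - x (n + k)) ^ 2 =
        ∑ i ∈ range k, p i * x (n + i) ^ 2 - 2 * x (n + k) * ∑ i ∈ range k, p i * x (n + i)
          + x (n + k) ^ 2 * ∑ i ∈ range k, p i := by
      rw [mul_sum, mul_sum, ← sum_sub_distrib, ← sum_add_distrib]
      exact sum_congr rfl fun i _ => by ring
    rw [h2, hp1, ← hx n]
    simp only [hE]
    linarith
  have hanti : Antitone E := antitone_nat_of_succ_le fun n => by
    have h : 0 ≤ ∑ i ∈ range k, p i * (x (n + i) - x (n + k)) ^ 2 :=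
      sum_nonneg fun i _ => mul_nonneg (hp i).le (sq_nonneg _)
    linarith [hvar n]
  have hbdd : BddBelow (Set.range E) :=
    ⟨0, by rintro _ ⟨n, rfl⟩; exact sum_nonneg fun i _ => mul_nonneg (hqpos i).le (sq_nonneg _)⟩
  have hlim := tendsto_atTop_ciInf hanti hbdd
  have hvar0 : Tendsto (fun n => E n - E (n + 1)) atTop (𝓝 0) := by
    simpa using hlim.sub (hlim.comp (tendsto_add_atTop_nat 1))
  have hdiff : ∀ i ∈ range k, Tendsto (fun n => x (n + i) - x (n + k)) atTop (𝓝 0) := by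
    intro i hi
    have h : Tendsto (fun n => p i * (x (n + i) - x (n + k)) ^ 2) atTop (𝓝 0) := by
      refine squeeze_zero (fun n => mul_nonneg (hp i).le (sq_nonneg _)) (fun n => ?_) hvar0
      rw [hvar n]
      exact single_le_sum (f := fun i => p i * (x (n + i) - x (n + k)) ^ 2)
        (fun j _ => mul_nonneg (hp j).le (sq_nonneg _)) hi
    have h2 := h.const_mul (p i)⁻¹
    simp only [inv_mul_cancel_left₀ (hp i).ne', mul_zero] at h2
    have h3 := h2.sqrt
    simp only [Real.sqrt_sq_eq_abs, Real.sqrt_zero] at h3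
    exact (tendsto_zero_iff_abs_tendsto_zero _).2 h3
  set Q := ∑ i ∈ range k, q i with hQ
  have hQpos : 0 < Q := sum_pos (fun i _ => hqpos i) hne
  have hWpos : 0 < ∑ i ∈ range k, q i * x i :=
    sum_pos' (fun i _ => mul_nonneg (hqpos i).le (hx0 i))
      ⟨0, mem_range.2 hk, mul_pos (hqpos 0) hpos⟩
  refine ⟨(∑ i ∈ range k, q i * x i) / Q, div_pos hWpos hQpos, ?_⟩
  rw [← tendsto_add_atTop_iff_nat k]
  have hsum : Tendsto (fun n => ∑ i ∈ range k, q i * (x (n + i) - x (n + k))) atTop (𝓝 0) := by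
    simpa using tendsto_finsetSum (range k) fun i hi => (hdiff i hi).const_mul (q i)
  have h := (hsum.const_sub (∑ i ∈ range k, q i * x i)).div_const Q
  rw [sub_zero] at h
  refine h.congr fun n => ?_
  simp only [mul_sub]
  rw [sum_sub_distrib, hW n, ← sum_mul, ← hQ, sub_sub_cancel, mul_div_cancel_left₀ _ hQpos.ne']

/-- If `T n` is equivalent to `c * lam ^ n` with `1 < lam`, then the ratio of consecutive partial
sums of `T` tends to `1 / lam`. -/
theorem tendsto_partialSum_ratio {T : ℕ → ℝ} {lam c : ℝ} (hlam : 1 < lam) (hc : 0 < c)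
    (hT : Tendsto (fun n => T n / lam ^ n) atTop (𝓝 c)) :
    Tendsto (fun m : ℕ => (∑ i ∈ range (m + 1), T i) / ∑ i ∈ range (m + 2), T i)
      atTop (𝓝 (1 / lam)) := by
  have hl0 : 0 < lam := by linarith
  have hl1 : 0 < lam - 1 := by linarith
  have hpow : ∀ n, lam ^ n ≠ 0 := fun n => (pow_pos hl0 n).ne'
  have hinv : Tendsto (fun n : ℕ => (lam ^ n)⁻¹) atTop (𝓝 0) :=
    (tendsto_pow_atTop_atTop_of_one_lt hlam).inv_tendsto_atTop
  have hgeom : Tendsto (fun n => (∑ i ∈ range n, lam ^ i) / lam ^ n) atTop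
      (𝓝 (1 / (lam - 1))) := by
    have h := (hinv.const_sub 1).div_const (lam - 1)
    rw [sub_zero] at h
    refine h.congr fun n => ?_
    rw [geom_sum_eq hlam.ne']
    have := hpow n
    field_simp
  have hsum : Tendsto (fun n => ∑ i ∈ range n, lam ^ i) atTop atTop := by
    refine tendsto_atTop_mono (fun n => ?_) tendsto_natCast_atTop_atTop
    have h : ∑ i ∈ range n, (1 : ℝ) ≤ ∑ i ∈ range n, lam ^ i :=
      sum_le_sum fun i _ => one_le_pow₀ hlam.le
    simpa using h
  have hlittle : (fun n => T n - c * lam ^ n) =o[atTop] fun n => lam ^ n := by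
    rw [isLittleO_iff_tendsto fun n h => absurd h (hpow n)]
    have h := hT.sub_const c
    rw [sub_self] at h
    refine h.congr fun n => ?_
    rw [sub_div, mul_div_cancel_right₀ _ (hpow n)]
  have hlim : Tendsto (fun n => (∑ i ∈ range n, T i) / lam ^ n) atTop (𝓝 (c / (lam - 1))) := by
    have h := ((hlittle.sum_range (fun n => (pow_pos hl0 n).le) hsum).tendsto_div_nhds_zero.mul
      hgeom).add (hgeom.const_mul c)
    rw [zero_mul, zero_add, mul_one_div] at h
    refine h.congr' ?_
    filter_upwards [hsum.eventually_gt_atTop 0] with n hn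
    have := hpow n
    rw [sum_sub_distrib, ← mul_sum]
    field_simp
    ring
  have hcl : c / (lam - 1) ≠ 0 := (div_pos hc hl1).ne'
  have h1 := hlim.comp (tendsto_add_atTop_nat 1)
  have h2 := hlim.comp (tendsto_add_atTop_nat 2)
  have h := (h1.div h2 hcl).div_const lam
  rw [div_self hcl] at h
  refine h.congr fun n => ?_
  simp only [Function.comp_apply, Pi.div_apply]
  have := hpow (n + 1)
  rw [pow_succ lam (n + 1), div_div_div_eq, div_div]
  rw [show lam ^ (n + 1) * (∑ i ∈ range (n + 2), T i) * lam =
    (∑ i ∈ range (n + 2), T i) * (lam ^ (n + 1) * lam) by ring]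
  exact mul_div_mul_right _ _ (mul_ne_zero this hl0.ne')

theorem sWord_iterate_append {k : ℕ} (n : ℕ) (u v : List (Fin k)) :
    sWord^[n] (u ++ v) = sWord^[n] u ++ sWord^[n] v := by
  induction n generalizing u v with
  | zero => rfl
  | succ n ih => simp only [Function.iterate_succ_apply, sWord, List.flatMap_append, ← ih]

theorem length_sWord_iterate_letter {k : ℕ} (z0 : Fin k) (hz : (z0 : ℕ) = 0) (n d : ℕ)
    (a : Fin k) (hd : 0 < d) (had : (a : ℕ) + d = k) :
    (sWord^[n + d] [a]).length = ∑ j ∈ range d, (sWord^[n + j] [z0]).length := by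
  have hz' : ∀ h, (⟨0, h⟩ : Fin k) = z0 := fun h => Fin.ext hz.symm
  induction d, Nat.succ_le_of_lt hd using Nat.le_induction generalizing a with
  | base =>
    have h : ¬ (a : ℕ) + 1 < k := by omega
    simp [sWord, sLetter, h, hz']
  | succ d hd1 ih =>
    have h : (a : ℕ) + 1 < k := by omega
    have hs : sWord [a] = [z0] ++ [⟨(a : ℕ) + 1, h⟩] := by simp [sWord, sLetter, h, hz']
    rw [← add_assoc, Function.iterate_succ_apply, hs, sWord_iterate_append, List.length_append,
      ih ⟨(a : ℕ) + 1, h⟩ hd1 (by change (a : ℕ) + 1 + d = k; omega), sum_range_succ _ d, add_comm]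

theorem length_bword {k : ℕ} (z : Fin k) (m : ℕ) :
    (bword z m).length = ∑ i ∈ range (m + 1), (sWord^[i] [z]).length := by
  rw [← sum_range_reflect, ← List.toFinset_range, List.sum_toFinset _ List.nodup_range]
  simp [bword, List.length_flatten, Function.comp_def]

theorem stmt17 (k : ℕ) (hk : 2 ≤ k) (z0 : Fin k) (hz : (z0 : ℕ) = 0)
    (lam : ℝ) (hlam : 1 < lam)
    (hroot : lam ^ k = ∑ j ∈ Finset.range k, lam ^ j) :
    Filter.Tendsto
      (fun m : ℕ => ((bword z0 m).length : ℝ) / ((bword z0 (m + 1)).length : ℝ))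
      Filter.atTop (nhds (1 / lam)) := by
  have hl0 : 0 < lam := by linarith
  have hpow : ∀ n, lam ^ n ≠ 0 := fun n => (pow_pos hl0 n).ne'
  obtain ⟨c, hc, hT⟩ := exists_pos_tendsto_of_weighted_average (k := k) (by omega)
    (p := fun i => lam ^ i / lam ^ k) (x := fun n => ((sWord^[n] [z0]).length : ℝ) / lam ^ n)
    (fun i => by positivity) (by rw [← sum_div, ← hroot, div_self (hpow k)])
    (fun n => by
      rw [length_sWord_iterate_letter z0 hz n k z0 (by omega) (by omega), Nat.cast_sum, sum_div]
      refine sum_congr rfl fun i _ => ?_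
      have := hpow n
      have := hpow i
      have := hpow k
      rw [pow_add, pow_add]
      field_simp)
    (fun n => by positivity) (by simp)
  have h := tendsto_partialSum_ratio hlam hc hT
  simpa only [length_bword, Nat.cast_sum] using h
end
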